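/- Let K_ν = F_q((θ⁻¹)) with q odd, G = SL₃(K_ν), Γ = SL₃(O_ν), Ω = G/Γ. Suppose X ⊆ Ω is a compact set invariant under H = SO(2x₁x₃ − x₂²) and z ∈ X is such that V₂(o')z ⊆ X for some open neighborhood o' of 0 in K_ν, where V₂(A) = {v₂(t) : t ∈ A}. Then there exists y ∈ X with V₂·y ⊆ X, where V₂ = {v₂(t) : t ∈ K_ν}. -/

import Mathlib

set_option synthInstance.maxHeartbeats 800000
set_option maxHeartbeats 1000000

open Topology

noncomputable section

abbrev Kv (F : Type) [Field F] := LaurentSeries F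

abbrev SL3 (F : Type) [Field F] := Matrix.SpecialLinearGroup (Fin 3) (Kv F)

instance (F : Type) [Field F] : TopologicalSpace (SL3 F) := instTopologicalSpaceSubtype

def theta (F : Type) [Field F] : Kv F := HahnSeries.single (-1) 1

def polyMap (F : Type) [Field F] : Polynomial F →+* Kv F :=
  (Polynomial.aeval (theta F)).toRingHom

def Gamma (F : Type) [Field F] : Subgroup (SL3 F) :=
  (Matrix.SpecialLinearGroup.map (polyMap F)).range

/-- `v₂(t)`, the elementary unipotent matrix with `t` in the `(1,3)` entry, in `SL₃(K_ν)`. -/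
def v2SL (F : Type) [Field F] (t : Kv F) : SL3 F :=
  ⟨!![1, 0, t; 0, 1, 0; 0, 0, 1], by
    simp [Matrix.det_fin_three, Matrix.vecHead, Matrix.vecTail]⟩

theorem SL3_isTopologicalGroup (F : Type) [Field F] : IsTopologicalGroup (SL3 F) :=
  @Matrix.SpecialLinearGroup.topologicalGroup (Fin 3) (Kv F) _ _ _ _ _

theorem coeff_theta_pow (F : Type) [Field F] (c : F) (n : ℕ) :
    algebraMap F (Kv F) c * theta F ^ n = HahnSeries.single (-(n:ℤ)) c := by
  rw [LaurentSeries.algebraMap_apply, HahnSeries.C_apply]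
  simp [theta, HahnSeries.single_pow]

theorem coeff_polyMap (F : Type) [Field F] (p : Polynomial F) (k : ℤ) :
    (polyMap F p).coeff k = if k ≤ 0 then p.coeff (-k).toNat else 0 := by
  have : polyMap F p = Polynomial.aeval (theta F) p := rfl
  rw [this]
  induction p using Polynomial.induction_on' with
  | add p q hp hq => 
    rw [map_add, HahnSeries.coeff_add, hp rfl, hq rfl]; split_ifs <;> simp
  | monomial n a =>
    rw [Polynomial.aeval_monomial, coeff_theta_pow, HahnSeries.coeff_single,
      Polynomial.coeff_monomial]
    split_ifs <;> first | rfl | omega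

theorem polyMap_injective (F : Type) [Field F] : Function.Injective (polyMap F) := by
  intro p q h
  ext n
  have := congrArg (fun x => HahnSeries.coeff x (-(n:ℤ))) h
  simpa [coeff_polyMap] using this

theorem mem_range_polyMap (F : Type) [Field F] (x : Kv F) :
    x ∈ Set.range (polyMap F) ↔ ∀ k : ℤ, 0 < k → x.coeff k = 0 := by
  constructor
  · rintro ⟨p, rfl⟩ k hk
    rw [coeff_polyMap, if_neg (by omega)]
  · intro h
    refine ⟨∑ i ∈ Finset.range ((-x.order).toNat + 1), Polynomial.monomial i (x.coeff (-(i:ℤ))), ?_⟩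
    ext k
    rw [coeff_polyMap]
    split_ifs with hk
    · simp only [Polynomial.finsetSum_coeff, Polynomial.coeff_monomial, Finset.sum_ite_eq',
        Finset.mem_range]
      split_ifs with h2
      · congr 1; omega
      · symm; apply HahnSeries.coeff_eq_zero_of_lt_order; omega
    · exact (h k (by omega)).symm

theorem isClosed_range_polyMap (F : Type) [Field F] : IsClosed (Set.range (polyMap F)) := by
  have : Set.range (polyMap F) = ⋂ k : ℤ, ⋂ _ : 0 < k, {x : Kv F | x.coeff k = 0} := by
    ext x; rw [mem_range_polyMap]; simp
  rw [this]
  refine isClosed_iInter fun k => isClosed_iInter fun _ => ?_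
  let _ : UniformSpace F := ⊥
  exact IsClosed.preimage (LaurentSeries.uniformContinuous_coeff k).continuous
    (isClosed_discrete ({0} : Set F))

theorem isClosed_Gamma (F : Type) [Field F] : IsClosed (Gamma F : Set (SL3 F)) := by
  have : (Gamma F : Set (SL3 F)) = ⋂ i, ⋂ j, {g : SL3 F | g.1 i j ∈ Set.range (polyMap F)} := by
    ext g
    simp only [Set.mem_iInter, Set.mem_ofPred_eq]
    constructor
    · rintro ⟨γ, rfl⟩ i j
      exact ⟨γ.1 i j, rfl⟩
    · intro h
      choose p hp using h
      refine ⟨⟨Matrix.of p, ?_⟩, ?_⟩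
      · apply polyMap_injective F
        rw [RingHom.map_det, map_one, ← g.2]
        congr 1
        ext1 i j
        exact hp i j
      · apply Subtype.ext
        ext1 i j
        exact hp i j
  rw [this]
  refine isClosed_iInter fun i => isClosed_iInter fun j => ?_
  refine (isClosed_range_polyMap F).preimage ?_
  exact (continuous_apply_apply i j).comp continuous_subtype_val

theorem tendsto_theta_inv (F : Type) [Field F] (t : Kv F) :
    Filter.Tendsto (fun n : ℕ => (theta F)⁻¹ ^ n * ((theta F)⁻¹ ^ n * t)) Filter.atTop (𝓝 0) := by
  have h : Filter.Tendsto (fun n : ℕ => (theta F)⁻¹ ^ n) Filter.atTop (𝓝 0) := by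
    apply Valued.tendsto_zero_pow_of_v_lt_one
    rw [theta, HahnSeries.inv_single, inv_one, LaurentSeries.valuation_single_zpow, ← WithZero.exp_zero,
      WithZero.exp_lt_exp]
    simp
  simpa using h.mul (h.mul_const t)

theorem theta_ne (F : Type) [Field F] : theta F ≠ 0 := by simp [theta]

def dSL (F : Type) [Field F] (n : ℕ) : SL3 F :=
  ⟨!![theta F ^ n, 0, 0; 0, 1, 0; 0, 0, (theta F)⁻¹ ^ n], by
    simp [Matrix.det_fin_three, theta_ne F]⟩

theorem v2_mul_d (F : Type) [Field F] (n : ℕ) (t : Kv F) :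
    v2SL F t * dSL F n = dSL F n * v2SL F ((theta F)⁻¹ ^ n * ((theta F)⁻¹ ^ n * t)) := by
  have h : theta F ^ n ≠ 0 := pow_ne_zero _ (theta_ne F)
  apply Subtype.ext
  change !![1, 0, t; 0, 1, 0; 0, 0, 1] *
      !![theta F ^ n, 0, 0; 0, 1, 0; 0, 0, (theta F)⁻¹ ^ n] =
    !![theta F ^ n, 0, 0; 0, 1, 0; 0, 0, (theta F)⁻¹ ^ n] *
      !![1, 0, (theta F)⁻¹ ^ n * ((theta F)⁻¹ ^ n * t); 0, 1, 0; 0, 0, 1]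
  ext1 i j
  fin_cases i <;> fin_cases j <;> simp [Matrix.mul_apply, Fin.sum_univ_three]
  field_simp

theorem quot_t2 (F : Type) [Field F] : T2Space (SL3 F ⧸ Gamma F) := by
  have := SL3_isTopologicalGroup F
  rw [t2Space_iff_of_isOpenQuotientMap
    (QuotientGroup.isOpenQuotientMap_mk (G := SL3 F) (N := Gamma F))]
  have h : {q : SL3 F × SL3 F | (q.1 : SL3 F ⧸ Gamma F) = (q.2 : SL3 F ⧸ Gamma F)} =
      (fun q : SL3 F × SL3 F => q.1⁻¹ * q.2) ⁻¹' (Gamma F : Set (SL3 F)) := by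
    ext q
    exact QuotientGroup.eq
  rw [h]
  exact (isClosed_Gamma F).preimage (by fun_prop)

/-- If a compact subset `X ⊆ Ω` is invariant under `H = SO(2x₁x₃ − x₂²)` and contains
`V₂(o')z` for some `z ∈ X` and open neighborhood `o'` of `0`, then `X` contains a full
`V₂`-orbit `V₂·y` of some `y ∈ X`. -/
theorem stmt_17 (F : Type) [Field F] [Fintype F] (hodd : ringChar F ≠ 2)
    (Q : (Fin 3 → Kv F) → Kv F)
    (hQ : ∀ u : Fin 3 → Kv F, Q u = 2 * u 0 * u 2 - (u 1) ^ 2)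
    (X : Set (SL3 F ⧸ Gamma F)) (hXcomp : IsCompact X)
    (hXinv : ∀ g : SL3 F, (∀ u : Fin 3 → Kv F, Q (g.1.mulVec u) = Q u) →
      ∀ x ∈ X, g • x ∈ X)
    (z : SL3 F ⧸ Gamma F) (hz : z ∈ X)
    (o' : Set (Kv F)) (ho' : IsOpen o') (h0 : (0 : Kv F) ∈ o')
    (hV2z : ∀ t ∈ o', v2SL F t • z ∈ X) :
    ∃ y ∈ X, ∀ t : Kv F, v2SL F t • y ∈ X := by
  have := SL3_isTopologicalGroup F
  have := quot_t2 F
  have hXc : IsClosed X := hXcomp.isClosed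
  have hd : ∀ n, ∀ x ∈ X, dSL F n • x ∈ X := by
    intro n
    apply hXinv
    intro u
    have h : theta F ^ n ≠ 0 := pow_ne_zero _ (theta_ne F)
    rw [hQ, hQ]
    simp [dSL, Matrix.mulVec, dotProduct, Fin.sum_univ_three]
    field_simp
  obtain ⟨y, hy, hc⟩ := hXcomp.exists_mapClusterPt (f := Filter.atTop)
    (u := fun n : ℕ => dSL F n • z)
    (Filter.tendsto_principal.2 (Filter.Eventually.of_forall fun n => hd n z hz))
  refine ⟨y, hy, fun t => ?_⟩
  by_contra hn
  have hev : ∀ᶠ x in 𝓝 y, v2SL F t • x ∉ X :=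
    (continuous_const_smul (v2SL F t)).continuousAt.eventually_mem
      (hXc.isOpen_compl.mem_nhds hn)
  have hev2 := (tendsto_theta_inv F t).eventually (ho'.mem_nhds h0)
  obtain ⟨n, h1, h2⟩ := ((hc.frequently hev).and_eventually hev2).exists
  apply h1
  rw [smul_smul, v2_mul_d, mul_smul]
  exact hd n _ (hV2z _ h2)

end
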